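/- arXiv:1501.04352 — 3 statements merged into one kernel-verified Lean document; each statement's English description precedes it below -/
import Mathlib

section
/- For every k ≥ 1, the AFBS iterates satisfy h(λ^k) − h(λ∞) ≤ a²·L·‖λ⁰ − λ∞‖² / (2·(k + a − 1)²). -/
open scoped RealInnerProductSpace

section GradientInequalities

variable {H : Type*} [NormedAddCommGroup H] [InnerProductSpace ℝ H] [CompleteSpace H]

theorem HasGradientAt.hasDerivAt_comp_line {h : H → ℝ} {v x d : H} {t : ℝ}
    (hv : HasGradientAt h v (x + t • d)) :
    HasDerivAt (fun s : ℝ => h (x + s • d)) ⟪v, d⟫ t := by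
  have hline : HasDerivAt (fun s : ℝ => x + s • d) d t := by
    simpa using ((hasDerivAt_id t).smul_const d).const_add x
  simpa [Function.comp_def] using (hasGradientAt_iff_hasFDerivAt.mp hv).comp_hasDerivAt t hline

/-- The first-order characterization of convexity, in terms of the gradient. -/
theorem ConvexOn.add_inner_gradient_le {h : H → ℝ} (hconv : ConvexOn ℝ Set.univ h)
    {v x : H} (hv : HasGradientAt h v x) (z : H) :
    h x + ⟪v, z - x⟫ ≤ h z := by
  have hline : ConvexOn ℝ Set.univ (fun s : ℝ => h (x + s • (z - x))) := by
    simpa [Function.comp_def, AffineMap.lineMap_apply, add_comm] using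
      hconv.comp_affineMap (AffineMap.lineMap (k := ℝ) x z)
  have hderiv : HasDerivAt (fun s : ℝ => h (x + s • (z - x))) ⟪v, z - x⟫ 0 :=
    HasGradientAt.hasDerivAt_comp_line (by simpa using hv)
  have hslope := hline.le_slope_of_hasDerivAt (Set.mem_univ 0) (Set.mem_univ 1) one_pos hderiv
  simp [slope_def_field] at hslope
  linarith

/-- The descent lemma for functions with Lipschitz gradient. -/
theorem le_add_inner_gradient_add_sq {h : H → ℝ} {g : H → H}
    (hgrad : ∀ x, HasGradientAt h (g x) x) {L : ℝ}
    (hLip : ∀ x y, ‖g x - g y‖ ≤ L * ‖x - y‖) (y x : H) :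
    h x ≤ h y + ⟪g y, x - y⟫ + L / 2 * ‖x - y‖ ^ 2 := by
  have hf : ∀ t : ℝ, HasDerivAt (fun s : ℝ => h (y + s • (x - y)))
      ⟪g (y + t • (x - y)), x - y⟫ t := fun t => (hgrad _).hasDerivAt_comp_line
  have hB : ∀ t : ℝ, HasDerivAt
      (fun s : ℝ => h y + s * ⟪g y, x - y⟫ + L / 2 * ‖x - y‖ ^ 2 * s ^ 2)
      (⟪g y, x - y⟫ + L * ‖x - y‖ ^ 2 * t) t := fun t => by
    have := (((hasDerivAt_id t).mul_const ⟪g y, x - y⟫).const_add (h y)).add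
      (((hasDerivAt_id t).pow 2).const_mul (L / 2 * ‖x - y‖ ^ 2))
    refine this.congr_deriv ?_
    simp
    ring
  have key := image_le_of_deriv_right_le_deriv_boundary (a := 0) (b := 1)
    (fun t _ => (hf t).continuousAt.continuousWithinAt)
    (fun t _ => (hf t).hasDerivWithinAt) (by simp)
    (fun t _ => (hB t).continuousAt.continuousWithinAt)
    (fun t _ => (hB t).hasDerivWithinAt)
    (fun t ht => by
      have hinner := real_inner_le_norm (g (y + t • (x - y)) - g y) (x - y)
      have hlip := hLip (y + t • (x - y)) y
      rw [add_sub_cancel_left, norm_smul, Real.norm_of_nonneg ht.1] at hlip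
      have := mul_le_mul_of_nonneg_right hlip (norm_nonneg (x - y))
      rw [inner_sub_left] at hinner
      linarith)
    (Set.right_mem_Icc.mpr zero_le_one)
  simpa using key

/-- The fundamental inequality for one projected gradient step. -/
theorem projected_gradient_step_le {K : Set H} (hK : Convex ℝ K) {h : H → ℝ}
    (hconv : ConvexOn ℝ Set.univ h) {g : H → H} (hgrad : ∀ x, HasGradientAt h (g x) x)
    {L : ℝ} (hL : 0 < L) (hLip : ∀ x y, ‖g x - g y‖ ≤ L * ‖x - y‖) {y p z : H} (hp : p ∈ K)
    (hpmin : ∀ w ∈ K, ‖y - (1 / L) • g y - p‖ ≤ ‖y - (1 / L) • g y - w‖) (hz : z ∈ K) :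
    h p - h z ≤ L / 2 * (‖y - z‖ ^ 2 - ‖p - z‖ ^ 2) := by
  have hinf : ‖y - (1 / L) • g y - p‖ = ⨅ w : K, ‖y - (1 / L) • g y - w‖ := by
    have : Nonempty K := ⟨⟨p, hp⟩⟩
    exact le_antisymm (le_ciInf fun w => hpmin w w.2)
      (ciInf_le ⟨0, by rintro _ ⟨w, rfl⟩; exact norm_nonneg _⟩ (⟨p, hp⟩ : K))
  have hproj := (norm_eq_iInf_iff_real_inner_le_zero hK hp).mp hinf z hz
  have hproj' : L * ⟪y - p, z - p⟫ ≤ ⟪g y, z - p⟫ := by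
    rw [sub_right_comm, inner_sub_left, real_inner_smul_left] at hproj
    have := mul_le_mul_of_nonneg_left hproj hL.le
    field_simp at this
    linarith
  have hdesc := le_add_inner_gradient_add_sq hgrad hLip y p
  have hfirst := hconv.add_inner_gradient_le (hgrad y) z
  have hsplit : ⟪g y, z - y⟫ = ⟪g y, z - p⟫ + ⟪g y, p - y⟫ := by
    rw [← inner_add_right, sub_add_sub_cancel]
  have hnorm : ‖y - z‖ ^ 2 = ‖p - y‖ ^ 2 - 2 * ⟪y - p, z - p⟫ + ‖p - z‖ ^ 2 := by
    rw [← sub_sub_sub_cancel_right y z p, norm_sub_sq_real, norm_sub_rev y p, norm_sub_rev z p]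
  rw [hnorm]
  linarith

end GradientInequalities

/-- AFBS function-value convergence rate: for every `k ≥ 1`,
`h(λ^k) − h(λ∞) ≤ a²·L·‖λ⁰ − λ∞‖² / (2·(k + a − 1)²)`. -/
theorem afbs_function_value_rate
    {H : Type*} [NormedAddCommGroup H] [InnerProductSpace ℝ H] [CompleteSpace H]
    (K : Set H) (hKne : K.Nonempty) (hKcl : IsClosed K) (hKcv : Convex ℝ K)
    (h : H → ℝ) (hconv : ConvexOn ℝ Set.univ h)
    (g : H → H) (hgrad : ∀ x, HasGradientAt h (g x) x)
    (L : ℝ) (hL : 0 < L) (hLip : ∀ x y, ‖g x - g y‖ ≤ L * ‖x - y‖)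
    (P : H → H)
    (hPmem : ∀ y, P y ∈ K)
    (hPmin : ∀ y, ∀ z ∈ K, ‖y - P y‖ ≤ ‖y - z‖)
    (a : ℝ) (ha : 2 < a)
    (lam lamhat : ℕ → H)
    (hhat0 : lamhat 0 = lam 0)
    (hhat : ∀ k : ℕ, 1 ≤ k →
      lamhat k = lam k + (((k : ℝ) - 1) / ((k : ℝ) + a)) • (lam k - lam (k - 1)))
    (hupd : ∀ k : ℕ, lam (k + 1) = P (lamhat k - (1 / L) • g (lamhat k)))
    (laminf : H) (hinfK : laminf ∈ K) (hinfmin : ∀ z ∈ K, h laminf ≤ h z) :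
    ∀ k : ℕ, 1 ≤ k →
      h (lam k) - h laminf ≤
        a ^ 2 * L * ‖lam 0 - laminf‖ ^ 2 / (2 * ((k : ℝ) + a - 1) ^ 2) := by
  have hmem : ∀ n, lam (n + 1) ∈ K := fun n => by rw [hupd]; exact hPmem _
  have hstep : ∀ n, ∀ z ∈ K, h (lam (n + 1)) - h z ≤
      L / 2 * (‖lamhat n - z‖ ^ 2 - ‖lam (n + 1) - z‖ ^ 2) := fun n z hz =>
    projected_gradient_step_le hKcv hconv hgrad hL hLip (hmem n)
      (fun w hw => by rw [hupd]; exact hPmin _ w hw) hz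
  have ha0 : 0 < a := by linarith
  have energy : ∀ n : ℕ, ((n + a) / a) ^ 2 * (h (lam (n + 1)) - h laminf) +
      L / 2 * ‖lam n + (((n : ℝ) + a) / a) • (lam (n + 1) - lam n) - laminf‖ ^ 2 ≤
      L / 2 * ‖lam 0 - laminf‖ ^ 2 := by
    intro n
    induction n with
    | zero =>
      have := hstep 0 laminf hinfK
      rw [hhat0] at this
      simp only [Nat.cast_zero, zero_add, div_self ha0.ne', one_smul, one_pow, one_mul,
        add_sub_cancel] at this ⊢
      linarith
    | succ n ih =>
      have hn : (0 : ℝ) ≤ n := n.cast_nonneg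
      have hy := hhat (n + 1) (by omega)
      have hc : (((n + 1 : ℕ) : ℝ) - 1) / (((n + 1 : ℕ) : ℝ) + a) =
          ((((n + 1 : ℕ) : ℝ) + a) / a)⁻¹ * ((n + a) / a - 1) := by
        have : (n : ℝ) + 1 + a ≠ 0 := by positivity
        push_cast
        field_simp
        ring
      have hts : ((((n + 1 : ℕ) : ℝ) + a) / a) ^ 2 - (((n + 1 : ℕ) : ℝ) + a) / a ≤
          ((n + a) / a) ^ 2 := by
        rw [← sub_nonneg]
        have : ((n + a) / a) ^ 2 - (((((n + 1 : ℕ) : ℝ) + a) / a) ^ 2 -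
            (((n + 1 : ℕ) : ℝ) + a) / a) = ((a - 2) * (n + a) + (a - 1)) / a ^ 2 := by
          push_cast
          field_simp
          ring
        rw [this]
        exact div_nonneg (add_nonneg (mul_nonneg (by linarith) (by positivity)) (by linarith))
          (sq_nonneg a)
      have ht1 : 1 ≤ (((n + 1 : ℕ) : ℝ) + a) / a := by
        rw [le_div_iff₀ ha0]
        push_cast
        linarith
      rw [hc, Nat.add_sub_cancel] at hy
      generalize (((n + 1 : ℕ) : ℝ) + a) / a = t at *
      generalize ((n : ℝ) + a) / a = s at *
      have ht0 : 0 < t := by linarith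
      have hrt : t⁻¹ * t = 1 := inv_mul_cancel₀ ht0.ne'
      have hr0 : 0 ≤ t⁻¹ := by positivity
      have hr1 : 0 ≤ 1 - t⁻¹ := sub_nonneg.mpr (inv_le_one_of_one_le₀ ht1)
      have hz := hKcv (hmem n) hinfK hr1 hr0 (sub_add_cancel 1 t⁻¹)
      have hhz := hconv.2 (Set.mem_univ (lam (n + 1))) (Set.mem_univ laminf) hr1 hr0
        (sub_add_cancel 1 t⁻¹)
      have hS := hstep (n + 1) _ hz
      have hy' : lamhat (n + 1) - ((1 - t⁻¹) • lam (n + 1) + t⁻¹ • laminf) =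
          t⁻¹ • (lam n + s • (lam (n + 1) - lam n) - laminf) := by
        rw [hy]
        module
      have hx' : lam (n + 1 + 1) - ((1 - t⁻¹) • lam (n + 1) + t⁻¹ • laminf) =
          t⁻¹ • (lam (n + 1) + t • (lam (n + 1 + 1) - lam (n + 1)) - laminf) := by
        rw [smul_sub, smul_add, smul_smul, hrt]
        module
      rw [hy', hx', norm_smul, norm_smul, Real.norm_of_nonneg hr0] at hS
      simp only [smul_eq_mul] at hhz
      have hw := hinfmin _ (hmem n)
      have hmul := mul_le_mul_of_nonneg_left (hS.trans' (sub_le_sub_left hhz _)) (sq_nonneg t)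
      have hscaled := mul_le_mul_of_nonneg_right hts (sub_nonneg.mpr hw)
      have hleft : t ^ 2 * (h (lam (n + 1 + 1)) -
          ((1 - t⁻¹) * h (lam (n + 1)) + t⁻¹ * h laminf)) =
          t ^ 2 * (h (lam (n + 1 + 1)) - h laminf) -
            (t ^ 2 - t) * (h (lam (n + 1)) - h laminf) := by
        field_simp
        ring
      have hright : ∀ A B : ℝ, t ^ 2 * (L / 2 * ((t⁻¹ * A) ^ 2 - (t⁻¹ * B) ^ 2)) =
          L / 2 * A ^ 2 - L / 2 * B ^ 2 := by
        intro A B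
        field_simp
      rw [hleft, hright] at hmul
      linarith
  intro k hk
  obtain ⟨n, rfl⟩ := Nat.exists_eq_add_of_le' hk
  have hna : (0 : ℝ) < n + a := by positivity
  have hE := energy n
  have hpos : 0 ≤ L / 2 * ‖lam n + (((n : ℝ) + a) / a) • (lam (n + 1) - lam n) - laminf‖ ^ 2 := by
    positivity
  have hmain : ((n + a) / a) ^ 2 * (h (lam (n + 1)) - h laminf) ≤
      L / 2 * ‖lam 0 - laminf‖ ^ 2 := by linarith
  rw [show ((n + 1 : ℕ) : ℝ) + a - 1 = n + a by push_cast; ring, le_div_iff₀ (by positivity)]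
  rw [div_pow, div_mul_eq_mul_div, div_le_iff₀ (by positivity)] at hmain
  linarith
end

section
/- For every k ≥ 1, the state iterates satisfy ‖x^k − x∞‖ ≤ a·‖B‖·√(L/μ)·‖λ⁰ − λ∞‖ / (k + a − 1), where ‖B‖ is the operator norm of B; i.e., the state sequence converges strongly to the optimal state sequence with rate O(1/k). -/
open scoped RealInnerProductSpace

section

variable {E : Type*} [NormedAddCommGroup E] [InnerProductSpace ℝ E]

/-- A strongly convex function grows quadratically away from a minimizer. -/
lemma StrongConvexOn.quadratic_growth {φ : E → ℝ} {m : ℝ} (hφ : StrongConvexOn Set.univ m φ)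
    {u : E} (hu : ∀ v, φ u ≤ φ v) (v : E) : m / 2 * ‖u - v‖ ^ 2 ≤ φ v - φ u := by
  have key : ∀ t : ℝ, 0 < t → t < 1 → (1 - t) * (m / 2 * ‖u - v‖ ^ 2) ≤ φ v - φ u := by
    intro t ht ht1
    have h1 := hφ.2 (Set.mem_univ u) (Set.mem_univ v) (sub_nonneg.2 ht1.le) ht.le (by ring)
    have h2 := hu ((1 - t) • u + t • v)
    simp only [smul_eq_mul] at h1
    refine le_of_mul_le_mul_left ?_ ht
    linarith
  have hlim : Filter.Tendsto (fun t : ℝ => (1 - t) * (m / 2 * ‖u - v‖ ^ 2))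
      (nhdsWithin 0 (Set.Ioi 0)) (nhds (m / 2 * ‖u - v‖ ^ 2)) := by
    have hc : Continuous fun t : ℝ => (1 - t) * (m / 2 * ‖u - v‖ ^ 2) := by fun_prop
    simpa using (hc.tendsto 0).mono_left nhdsWithin_le_nhds
  refine le_of_tendsto hlim ?_
  filter_upwards [Ioo_mem_nhdsGT (zero_lt_one' ℝ)] with t ht using key t ht.1 ht.2

/-- A metric projection onto a convex set satisfies the variational inequality. -/
lemma Convex.inner_sub_proj_le_zero {K : Set E} (hK : Convex ℝ K) {y p z : E} (hp : p ∈ K)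
    (hmin : ∀ w ∈ K, ‖y - p‖ ≤ ‖y - w‖) (hz : z ∈ K) : ⟪y - p, z - p⟫ ≤ 0 := by
  refine (norm_eq_iInf_iff_real_inner_le_zero hK hp).1 ?_ z hz
  have : Nonempty K := ⟨⟨p, hp⟩⟩
  refine le_antisymm (le_ciInf fun w => hmin w w.2) ?_
  exact ciInf_le ⟨0, by rintro _ ⟨w, rfl⟩; exact norm_nonneg _⟩ (⟨p, hp⟩ : K)

variable [CompleteSpace E] {h : E → ℝ} {g : E → E} {L : ℝ}

lemma HasGradientAt.hasDerivAt_line {y d g' : E} {s : ℝ} (hg : HasGradientAt h g' (y + s • d)) :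
    HasDerivAt (fun r : ℝ => h (y + r • d)) ⟪g', d⟫ s := by
  have h1 : HasDerivAt (fun r : ℝ => y + r • d) d s := by
    simpa using ((hasDerivAt_id s).smul_const d).const_add y
  simpa [Function.comp_def] using hg.hasFDerivAt.comp_hasDerivAt s h1

/-- The descent lemma for a function with Lipschitz gradient. -/
lemma le_add_inner_add_of_lipschitz_gradient (hg : ∀ x, HasGradientAt h (g x) x)
    (hLip : ∀ x y, ‖g x - g y‖ ≤ L * ‖x - y‖) (y p : E) :
    h p ≤ h y + ⟪g y, p - y⟫ + L / 2 * ‖p - y‖ ^ 2 := by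
  set d := p - y with hd
  let φ : ℝ → ℝ := fun s => h (y + s • d) - s * ⟪g y, d⟫ - s ^ 2 * (L / 2 * ‖d‖ ^ 2)
  have hφ : ∀ s, HasDerivAt φ (⟪g (y + s • d), d⟫ - ⟪g y, d⟫ - s * (L * ‖d‖ ^ 2)) s := by
    intro s
    have h1 := (hg (y + s • d)).hasDerivAt_line
    have h2 := (hasDerivAt_id s).mul_const ⟪g y, d⟫
    have h3 := (hasDerivAt_pow 2 s).mul_const (L / 2 * ‖d‖ ^ 2)
    refine ((h1.sub h2).sub h3).congr_deriv ?_
    norm_num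
    ring
  have hanti : AntitoneOn φ (Set.Icc 0 1) := by
    refine antitoneOn_of_deriv_nonpos (convex_Icc 0 1)
      (fun s _ => (hφ s).continuousAt.continuousWithinAt)
      (fun s _ => (hφ s).differentiableAt.differentiableWithinAt) fun s hs => ?_
    rw [interior_Icc] at hs
    rw [(hφ s).deriv, ← inner_sub_left]
    have h1 := real_inner_le_norm (g (y + s • d) - g y) d
    have h2 := hLip (y + s • d) y
    rw [add_sub_cancel_left, norm_smul, Real.norm_of_nonneg hs.1.le] at h2
    nlinarith [mul_le_mul_of_nonneg_right h2 (norm_nonneg d)]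
  have h01 := hanti (Set.left_mem_Icc.2 zero_le_one) (Set.right_mem_Icc.2 zero_le_one) zero_le_one
  simp only [φ, hd, one_smul, zero_smul, add_zero, add_sub_cancel] at h01
  linarith

/-- The gradient inequality for a differentiable convex function. -/
lemma ConvexOn.add_inner_gradient_le_s4 (hc : ConvexOn ℝ Set.univ h) {y g' : E}
    (hg : HasGradientAt h g' y) (z : E) : h y + ⟪g', z - y⟫ ≤ h z := by
  have hd : HasDerivAt (fun r : ℝ => h (y + r • (z - y))) ⟪g', z - y⟫ 0 :=
    HasGradientAt.hasDerivAt_line (by simpa using hg)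
  have hcl : ConvexOn ℝ Set.univ (fun r : ℝ => h (y + r • (z - y))) := by
    refine ⟨convex_univ, fun r _ s _ α β hα hβ hαβ => ?_⟩
    have := hc.2 (Set.mem_univ (y + r • (z - y))) (Set.mem_univ (y + s • (z - y))) hα hβ hαβ
    convert this using 2
    obtain rfl : β = 1 - α := by linarith
    simp only [smul_eq_mul]
    module
  have := hcl.le_slope_of_hasDerivAt (Set.mem_univ 0) (Set.mem_univ 1) zero_lt_one hd
  simp [slope_def_field] at this
  linarith

/-- The fundamental inequality of a projected gradient step with step size `1 / L`. -/
lemma projected_gradient_step (hL : 0 < L) {K : Set E} (hK : Convex ℝ K)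
    (hc : ConvexOn ℝ Set.univ h) (hg : ∀ x, HasGradientAt h (g x) x)
    (hLip : ∀ x y, ‖g x - g y‖ ≤ L * ‖x - y‖) {y p z : E} (hp : p ∈ K)
    (hmin : ∀ w ∈ K, ‖y - (1 / L) • g y - p‖ ≤ ‖y - (1 / L) • g y - w‖) (hz : z ∈ K) :
    h p ≤ h z + L / 2 * (‖y - z‖ ^ 2 - ‖p - z‖ ^ 2) := by
  have h1 := le_add_inner_add_of_lipschitz_gradient hg hLip y p
  have h2 := hc.add_inner_gradient_le_s4 (hg y) z
  have h3 := hK.inner_sub_proj_le_zero hp hmin hz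
  have e1 : y - (1 / L) • g y - p = (y - p) - (1 / L) • g y := by abel
  rw [e1, inner_sub_left, real_inner_smul_left] at h3
  have h4 : L * ⟪y - p, z - p⟫ ≤ ⟪g y, z - p⟫ := by
    have := mul_le_mul_of_nonneg_left h3 hL.le
    rw [mul_sub, ← mul_assoc, mul_one_div_cancel hL.ne', one_mul, mul_zero] at this
    linarith
  have e2 : ⟪g y, z - p⟫ = ⟪g y, z - y⟫ - ⟪g y, p - y⟫ := by
    rw [← inner_sub_right]; congr 1; abel
  have e3 : ‖y - z‖ ^ 2 = ‖y - p‖ ^ 2 - 2 * ⟪y - p, z - p⟫ + ‖z - p‖ ^ 2 := by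
    rw [← norm_sub_sq_real]; congr 2; abel
  rw [e3, norm_sub_rev p z, norm_sub_rev y p]
  linarith

/-- One step of the energy estimate for the accelerated projected gradient method. -/
lemma accelerated_step (hL : 0 < L) {K : Set E} (hK : Convex ℝ K)
    (hc : ConvexOn ℝ Set.univ h) (hg : ∀ x, HasGradientAt h (g x) x)
    (hLip : ∀ x y, ‖g x - g y‖ ≤ L * ‖x - y‖) {x y p w : E} {t : ℝ} (ht : 1 ≤ t) (hp : p ∈ K)
    (hmin : ∀ v ∈ K, ‖y - (1 / L) • g y - p‖ ≤ ‖y - (1 / L) • g y - v‖) (hx : x ∈ K)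
    (hw : w ∈ K) :
    t ^ 2 * (h p - h w) + L / 2 * ‖t • p - (t - 1) • x - w‖ ^ 2 ≤
      (t ^ 2 - t) * (h x - h w) + L / 2 * ‖t • y - (t - 1) • x - w‖ ^ 2 := by
  have ht0 : 0 < t := by linarith
  have ht1 : 0 ≤ 1 - 1 / t := by
    rw [sub_nonneg, div_le_one ht0]; exact ht
  have hsum : (1 - 1 / t) + 1 / t = 1 := by ring
  set z := (1 - 1 / t) • x + (1 / t) • w with hz
  have hzK : z ∈ K := hK hx hw ht1 (by positivity) hsum
  have h1 := projected_gradient_step hL hK hc hg hLip hp hmin hzK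
  have h2 := hc.2 (Set.mem_univ x) (Set.mem_univ w) ht1 (by positivity : 0 ≤ 1 / t) hsum
  have scale : ∀ q : E, ‖t • q - (t - 1) • x - w‖ ^ 2 = t ^ 2 * ‖q - z‖ ^ 2 := by
    intro q
    have : t • q - (t - 1) • x - w = t • (q - z) := by
      rw [hz, smul_sub, smul_add, smul_smul, smul_smul, mul_sub, mul_one,
        mul_one_div_cancel ht0.ne', one_smul]
      abel
    rw [this, norm_smul, mul_pow, Real.norm_of_nonneg ht0.le]
  rw [scale, scale]
  rw [← hz, smul_eq_mul, smul_eq_mul] at h2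
  have h3 : t ^ 2 * h p ≤ t ^ 2 * ((1 - 1 / t) * h x + 1 / t * h w
      + L / 2 * (‖y - z‖ ^ 2 - ‖p - z‖ ^ 2)) :=
    mul_le_mul_of_nonneg_left (by linarith) (by positivity)
  have e : t ^ 2 * ((1 - 1 / t) * h x + 1 / t * h w) = (t ^ 2 - t) * h x + t * h w := by
    field_simp
  linarith

/-- The `O(1 / k ^ 2)` rate of the accelerated projected gradient method. -/
lemma accelerated_rate (hL : 0 < L) {K : Set E} (hK : Convex ℝ K)
    (hc : ConvexOn ℝ Set.univ h) (hg : ∀ x, HasGradientAt h (g x) x)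
    (hLip : ∀ x y, ‖g x - g y‖ ≤ L * ‖x - y‖) {w : E} (hw : w ∈ K) (hwmin : ∀ z ∈ K, h w ≤ h z)
    {P : E → E} (hPmem : ∀ y, P y ∈ K) (hPmin : ∀ y, ∀ z ∈ K, ‖y - P y‖ ≤ ‖y - z‖)
    {a : ℝ} (ha : 2 ≤ a) {x y : ℕ → E} (hy0 : y 0 = x 0)
    (hy : ∀ k : ℕ, 1 ≤ k → y k = x k + (((k : ℝ) - 1) / ((k : ℝ) + a)) • (x k - x (k - 1)))
    (hx : ∀ k : ℕ, x (k + 1) = P (y k - (1 / L) • g (y k))) (k : ℕ) :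
    (((k : ℝ) + a) / a) ^ 2 * (h (x (k + 1)) - h w) ≤ L / 2 * ‖x 0 - w‖ ^ 2 := by
  have ha0 : 0 < a := by linarith
  have hxK : ∀ n, x (n + 1) ∈ K := fun n => hx n ▸ hPmem _
  suffices H : ∀ n : ℕ, (((n : ℝ) + a) / a) ^ 2 * (h (x (n + 1)) - h w)
      + L / 2 * ‖(((n : ℝ) + a) / a) • x (n + 1) - (((n : ℝ) + a) / a - 1) • x n - w‖ ^ 2
      ≤ L / 2 * ‖x 0 - w‖ ^ 2 by
    refine le_trans ?_ (H k)
    have : 0 ≤ L / 2 := by positivity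
    exact le_add_of_nonneg_right (by positivity)
  intro n
  induction n with
  | zero =>
    have h1 := projected_gradient_step hL hK hc hg hLip (hx 0 ▸ hPmem _)
      (hx 0 ▸ hPmin (y 0 - (1 / L) • g (y 0))) hw
    simp only [Nat.cast_zero, zero_add, div_self ha0.ne', one_pow, one_mul, one_smul, sub_self,
      zero_smul, sub_zero]
    rw [hy0] at h1
    linarith
  | succ n ih =>
    refine le_trans ?_ ih
    set s : ℝ := ((n : ℝ) + a) / a with hs
    have ht : (((n + 1 : ℕ) : ℝ) + a) / a = s + 1 / a := by
      rw [hs]; push_cast; ring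
    rw [ht]
    have hs1 : 1 ≤ s := by
      rw [hs, le_div_iff₀ ha0]; linarith [(Nat.cast_nonneg n : (0 : ℝ) ≤ n)]
    have hia : 0 < 1 / a := by positivity
    have hia2 : 1 / a ≤ 1 / 2 := one_div_le_one_div_of_le two_pos ha
    have hstep := accelerated_step hL hK hc hg hLip (by linarith : 1 ≤ s + 1 / a)
      (hx (n + 1) ▸ hPmem _) (hx (n + 1) ▸ hPmin (y (n + 1) - (1 / L) • g (y (n + 1)))) (hxK n) hw
    refine hstep.trans (add_le_add ?_ (le_of_eq ?_))
    · refine mul_le_mul_of_nonneg_right ?_ (sub_nonneg.2 (hwmin _ (hxK n)))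
      nlinarith
    · congr 3
      have hcoef : (s + 1 / a) * ((((n + 1 : ℕ) : ℝ) - 1) / (((n + 1 : ℕ) : ℝ) + a)) = s - 1 := by
        have : (0 : ℝ) < n + 1 + a := by positivity
        rw [hs]; push_cast; field_simp; ring
      rw [hy (n + 1) (by omega), Nat.add_sub_cancel, smul_add, smul_smul, hcoef]
      module

end

/-- Strong convergence of the state sequence with rate `O(1/k)`:
`‖x^k − x∞‖ ≤ a·‖B‖·√(L/μ)·‖λ⁰ − λ∞‖ / (k + a − 1)` for all `k ≥ 1`. -/
theorem afbs_state_rate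
    {Hu Hl : Type*} [NormedAddCommGroup Hu] [InnerProductSpace ℝ Hu] [CompleteSpace Hu]
    [NormedAddCommGroup Hl] [InnerProductSpace ℝ Hl] [CompleteSpace Hl]
    (μ : ℝ) (hμ : 0 < μ)
    (f : Hu → ℝ)
    (hf : ConvexOn ℝ Set.univ (fun u => f u - μ / 2 * ‖u‖ ^ 2))
    (C : Hu →L[ℝ] Hl) (c : Hl)
    (K : Set Hl) (hKne : K.Nonempty) (hKcl : IsClosed K) (hKcv : Convex ℝ K)
    (Lag : Hu → Hl → ℝ)
    (hLag : ∀ v lam, Lag v lam = f v + ⟪lam, c - C v⟫)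
    -- the unique minimizer of the Lagrangian in its first argument
    (u : Hl → Hu)
    (humin : ∀ lam : Hl, ∀ v : Hu, Lag (u lam) lam ≤ Lag v lam)
    (huniq : ∀ lam : Hl, ∀ v : Hu, (∀ v' : Hu, Lag v lam ≤ Lag v' lam) → v = u lam)
    -- the dual objective and its smoothness
    (h : Hl → ℝ)
    (hdef : ∀ lam, h lam = -(Lag (u lam) lam))
    (hconv : ConvexOn ℝ Set.univ h)
    (g : Hl → Hl) (hgrad : ∀ x, HasGradientAt h (g x) x)
    (L : ℝ) (hL : 0 < L) (hLip : ∀ x y, ‖g x - g y‖ ≤ L * ‖x - y‖)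
    -- the saddle point
    (uinf : Hu) (laminf : Hl) (hinfK : laminf ∈ K)
    (hsaddle1 : ∀ v : Hu, Lag uinf laminf ≤ Lag v laminf)
    (hsaddle2 : ∀ lam ∈ K, Lag uinf lam ≤ Lag uinf laminf)
    (hinfmin : ∀ z ∈ K, h laminf ≤ h z)
    -- projection onto K
    (P : Hl → Hl)
    (hPmem : ∀ y, P y ∈ K)
    (hPmin : ∀ y, ∀ z ∈ K, ‖y - P y‖ ≤ ‖y - z‖)
    -- AFBS iterates
    (a : ℝ) (ha : 2 < a)
    (lam lamhat : ℕ → Hl)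
    (hhat0 : lamhat 0 = lam 0)
    (hhat : ∀ k : ℕ, 1 ≤ k →
      lamhat k = lam k + (((k : ℝ) - 1) / ((k : ℝ) + a)) • (lam k - lam (k - 1)))
    (hupd : ∀ k : ℕ, lam (k + 1) = P (lamhat k - (1 / L) • g (lamhat k)))
    -- the state sequences
    {Hx : Type*} [NormedAddCommGroup Hx] [InnerProductSpace ℝ Hx]
    (B : Hu →L[ℝ] Hx) (a₀ : Hx)
    (x : ℕ → Hx) (hx : ∀ k : ℕ, x k = a₀ + B (u (lam k)))
    (xinf : Hx) (hxinf : xinf = a₀ + B uinf) :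
    ∀ k : ℕ, 1 ≤ k →
      ‖x k - xinf‖ ≤
        a * ‖B‖ * Real.sqrt (L / μ) * ‖lam 0 - laminf‖ / ((k : ℝ) + a - 1) := by
  intro k hk
  obtain ⟨n, rfl⟩ : ∃ n, k = n + 1 := ⟨k - 1, by omega⟩
  have hrate := accelerated_rate hL hKcv hconv hgrad hLip hinfK hinfmin hPmem hPmin ha.le
    hhat0 hhat hupd n
  have hmem : lam (n + 1) ∈ K := hupd n ▸ hPmem _
  have hsc : StrongConvexOn Set.univ μ (fun v => Lag v (lam (n + 1))) := by
    rw [strongConvexOn_iff_convex]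
    have hlin : ConvexOn ℝ Set.univ fun v => ⟪lam (n + 1), c - C v⟫ := by
      refine ⟨convex_univ, fun v _ w _ α β _ _ hαβ => le_of_eq ?_⟩
      obtain rfl : β = 1 - α := by linarith
      simp only [map_add, map_smul, inner_sub_right, inner_add_right, real_inner_smul_right,
        smul_eq_mul]
      ring
    refine (hf.add hlin).congr fun v _ => ?_
    simp only [hLag, Pi.add_apply]
    ring
  have hgrow := hsc.quadratic_growth (humin (lam (n + 1))) uinf
  have hgap : μ / 2 * ‖u (lam (n + 1)) - uinf‖ ^ 2 ≤ h (lam (n + 1)) - h laminf := by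
    have h1 := hsaddle2 _ hmem
    have h2 := hsaddle1 (u laminf)
    rw [hdef, hdef]
    linarith
  have ha0 : 0 < a := by linarith
  have hna : 0 < (n : ℝ) + a := by positivity
  have hu : ‖u (lam (n + 1)) - uinf‖ ≤
      a * Real.sqrt (L / μ) * ‖lam 0 - laminf‖ / ((n : ℝ) + a) := by
    refine le_of_sq_le_sq ?_ (by positivity)
    rw [div_pow, mul_pow, mul_pow, Real.sq_sqrt (by positivity), le_div_iff₀ (by positivity)]
    have h1 := (mul_le_mul_of_nonneg_left hgap (sq_nonneg (((n : ℝ) + a) / a))).trans hrate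
    rw [div_pow, div_mul_eq_mul_div, div_le_iff₀ (by positivity)] at h1
    have h2 : a ^ 2 * (L / μ) * ‖lam 0 - laminf‖ ^ 2 = a ^ 2 * L * ‖lam 0 - laminf‖ ^ 2 / μ := by
      ring
    rw [h2, le_div_iff₀ hμ]
    linarith
  rw [hx, hxinf, add_sub_add_left_eq_sub, ← map_sub]
  calc ‖B (u (lam (n + 1)) - uinf)‖ ≤ ‖B‖ * ‖u (lam (n + 1)) - uinf‖ := B.le_opNorm _
    _ ≤ ‖B‖ * (a * Real.sqrt (L / μ) * ‖lam 0 - laminf‖ / ((n : ℝ) + a)) := by gcongr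
    _ = _ := by push_cast; ring
end

section
/- If f(p) ≤ f(y) + ⟨p − y, ∇f(y)⟩ + (L/2)·‖p − y‖², then for every λ ∈ K: f(λ) − f(p) ≥ (L/2)·‖p − y‖² + L·⟨y − λ, p − y⟩. -/
open scoped RealInnerProductSpace

/-- The first-order characterization of convexity: a convex function lies above its tangents. -/
theorem ConvexOn.add_inner_gradient_le_s10
    {H : Type*} [NormedAddCommGroup H] [InnerProductSpace ℝ H] [CompleteSpace H]
    {s : Set H} {f : H → ℝ} (hf : ConvexOn ℝ s f) {g y x : H} (hg : HasGradientAt f g y)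
    (hy : y ∈ s) (hx : x ∈ s) : f y + ⟪g, x - y⟫ ≤ f x := by
  have hderiv : HasDerivAt (f ∘ AffineMap.lineMap (k := ℝ) y x) ⟪g, x - y⟫ 0 := by
    have h : HasFDerivAt f (InnerProductSpace.toDual ℝ H g) (AffineMap.lineMap y x (0 : ℝ)) := by
      simpa using hg.hasFDerivAt
    simpa using h.comp_hasDerivAt (0 : ℝ) AffineMap.hasDerivAt_lineMap
  have hslope := (hf.comp_affineMap (AffineMap.lineMap (k := ℝ) y x)).le_slope_of_hasDerivAt
    (x := 0) (y := 1) (by simpa using hy) (by simpa using hx) one_pos hderiv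
  simp [slope_def_field] at hslope
  linarith

/-- The variational inequality satisfied by a nearest point of a convex set. -/
theorem Convex.inner_sub_sub_nonpos_of_norm_sub_le
    {H : Type*} [NormedAddCommGroup H] [InnerProductSpace ℝ H]
    {K : Set H} (hK : Convex ℝ K) {z p : H} (hp : p ∈ K)
    (hmin : ∀ q ∈ K, ‖z - p‖ ≤ ‖z - q‖) {q : H} (hq : q ∈ K) : ⟪z - p, q - p⟫ ≤ 0 := by
  refine (norm_eq_iInf_iff_real_inner_le_zero hK hp).1 (le_antisymm ?_ ?_) q hq
  · have : Nonempty K := ⟨⟨p, hp⟩⟩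
    exact le_ciInf fun w => hmin w w.2
  · exact ciInf_le (f := fun w : K => ‖z - w‖)
      ⟨0, Set.forall_mem_range.2 fun w => norm_nonneg _⟩ ⟨p, hp⟩

/-- Descent lemma (Lemma 2.3 of Beck–Teboulle): if the quadratic model upper-bounds
`f` at `p = P_K(y − (1/L)∇f(y))`, then for every `λ ∈ K`,
`f(λ) − f(p) ≥ (L/2)‖p − y‖² + L⟨y − λ, p − y⟩`. -/
theorem fista_descent_lemma
    {H : Type*} [NormedAddCommGroup H] [InnerProductSpace ℝ H] [CompleteSpace H]
    (K : Set H) (hKne : K.Nonempty) (hKcl : IsClosed K) (hKcv : Convex ℝ K)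
    (f : H → ℝ) (hconv : ConvexOn ℝ Set.univ f)
    (g : H → H) (hgrad : ∀ x, HasGradientAt f (g x) x)
    (P : H → H)
    (hPmem : ∀ z, P z ∈ K)
    (hPmin : ∀ z, ∀ q ∈ K, ‖z - P z‖ ≤ ‖z - q‖)
    (L : ℝ) (hL : 0 < L) (y : H)
    (p : H) (hp : p = P (y - (1 / L) • g y))
    (hmajor : f p ≤ f y + ⟪p - y, g y⟫ + L / 2 * ‖p - y‖ ^ 2) :
    ∀ lam ∈ K,
      L / 2 * ‖p - y‖ ^ 2 + L * ⟪y - lam, p - y⟫ ≤ f lam - f p := by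
  intro lam hlam
  have htangent := hconv.add_inner_gradient_le_s10 (hgrad y) (Set.mem_univ y) (Set.mem_univ lam)
  have hproj : ⟪y - (1 / L) • g y - p, lam - p⟫ ≤ 0 := by
    subst hp
    exact hKcv.inner_sub_sub_nonpos_of_norm_sub_le (hPmem _) (hPmin _) hlam
  have hscaled : L * ⟪y - p, lam - p⟫ ≤ ⟪g y, lam - p⟫ := by
    rw [sub_right_comm, inner_sub_left, real_inner_smul_left, sub_nonpos, one_div_mul_eq_div,
      le_div_iff₀ hL] at hproj
    linarith
  have hsplit : ⟪y - p, lam - p⟫ = ‖p - y‖ ^ 2 + ⟪y - lam, p - y⟫ := by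
    rw [← real_inner_self_eq_norm_sq, ← inner_add_left, real_inner_comm, ← inner_neg_neg]
    congr 1 <;> abel
  have hgsplit : ⟪g y, lam - p⟫ = ⟪g y, lam - y⟫ - ⟪p - y, g y⟫ := by
    rw [real_inner_comm (g y) (p - y), ← inner_sub_right, sub_sub_sub_cancel_right]
  rw [hsplit, mul_add] at hscaled
  linarith
end
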